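/- Let α, ν ∈ ℝ. The integral ∫_Λ Δ(y+u)^{−α} Δ(y)^{ν−n/2} dy (u ∈ Λ) converges if and only if ν > n/2 − 1 and α > ν + n/2 − 1; in that case there is a constant c_α, depending only on α, ν and n, such that ∫_Λ Δ(y+u)^{−α} Δ(y)^{ν−n/2} dy = c_α Δ(u)^{ν−α} for all u ∈ Λ. -/

import Mathlib

open MeasureTheory Complex Set
open scoped ENNReal

noncomputable section

/-- The Lorentz form `Δ(y) = y₁² − y₂² − ⋯ − yₙ²` on `ℝⁿ`
(written as `2 y₀² − ∑ yᵢ²` with 0-based indexing). -/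
def lor {n : ℕ} [NeZero n] (y : Fin n → ℝ) : ℝ := 2 * y 0 ^ 2 - ∑ i, y i ^ 2

/-- The holomorphic extension of the Lorentz form to `ℂⁿ`. -/
def lorC {n : ℕ} [NeZero n] (z : Fin n → ℂ) : ℂ := 2 * z 0 ^ 2 - ∑ i, z i ^ 2

/-- Componentwise imaginary part. -/
def imP {n : ℕ} (z : Fin n → ℂ) : Fin n → ℝ := fun i => (z i).im

/-- The forward light cone `Λ`. -/
def cone (n : ℕ) [NeZero n] : Set (Fin n → ℝ) := {y | 0 < lor y ∧ 0 < y 0}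

/-- The tube domain `T_Λ` over the forward light cone. -/
def tube (n : ℕ) [NeZero n] : Set (Fin n → ℂ) := {z | imP z ∈ cone n}

/-- The weighted measure `dV_ν = Δ(Im z)^{ν − n/2} dz` on `T_Λ`. -/
def dV (n : ℕ) [NeZero n] (ν : ℝ) : Measure (Fin n → ℂ) :=
  ((volume : Measure (Fin n → ℂ)).restrict (tube n)).withDensity
    (fun z => ENNReal.ofReal (lor (imP z) ^ (ν - (n : ℝ) / 2)))

/-- `∫ |F|^p dV_ν` (as an extended nonnegative real). -/
def lpInt (n : ℕ) [NeZero n] (p ν : ℝ) (F : (Fin n → ℂ) → ℂ) : ℝ≥0∞ :=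
  ∫⁻ z, ENNReal.ofReal (‖F z‖ ^ p) ∂(dV n ν)

/-- The `L^p_ν` norm `(∫ |F|^p dV_ν)^{1/p}`. -/
def lpNorm (n : ℕ) [NeZero n] (p ν : ℝ) (F : (Fin n → ℂ) → ℂ) : ℝ≥0∞ :=
  (lpInt n p ν F) ^ (1 / p)

/-- The Bergman space `A^p_ν`: holomorphic on `T_Λ` and in `L^p_ν`. -/
def memA (n : ℕ) [NeZero n] (p ν : ℝ) (F : (Fin n → ℂ) → ℂ) : Prop :=
  DifferentiableOn ℂ F (tube n) ∧ lpInt n p ν F < ⊤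

/-- Partial derivative `∂/∂zᵢ`. -/
def pd {n : ℕ} (i : Fin n) (F : (Fin n → ℂ) → ℂ) : (Fin n → ℂ) → ℂ :=
  fun z => fderiv ℂ F z (Pi.single i 1)

/-- The wave (Box) operator `□ = −(∂₁² − ∂₂² − ⋯ − ∂ₙ²)`, so that
`□ e^{i z·ξ} = Δ(ξ) e^{i z·ξ}`. -/
def BoxOp {n : ℕ} [NeZero n] (F : (Fin n → ℂ) → ℂ) : (Fin n → ℂ) → ℂ :=
  fun z => -(2 * pd 0 (pd 0 F) z - ∑ i, pd i (pd i F) z)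

/-- The (unnormalized) Bergman kernel `B_β(z,w) = Δ((z − w̄)/i)^{−(β+n)}`. -/
def berg (n : ℕ) [NeZero n] (β : ℝ) (z w : Fin n → ℂ) : ℂ :=
  lorC (fun i => (z i - (starRingEnd ℂ) (w i)) / Complex.I) ^ (-(β + (n : ℝ)) : ℂ)

/-- The Hardy inequality holds for `(p, ν)`:
`∫ |F|^p dV_ν ≤ C ∫ |Δ(Im z) □F(z)|^p dV_ν(z)` for all `F ∈ A^p_ν`. -/
def hardy (n : ℕ) [NeZero n] (p ν : ℝ) : Prop :=
  ∃ C > (0 : ℝ), ∀ F, memA n p ν F →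
    lpInt n p ν F ≤ ENNReal.ofReal C *
      lpInt n p ν (fun z => (lor (imP z) : ℂ) * BoxOp F z)

/-- `g` is the orthogonal projection of `f ∈ L²_ν` onto the closed subspace `A²_ν`:
`g ∈ A²_ν` and `f − g ⊥ A²_ν`. -/
def isProj (n : ℕ) [NeZero n] (ν : ℝ) (f g : (Fin n → ℂ) → ℂ) : Prop :=
  memA n 2 ν g ∧ ∀ h, memA n 2 ν h →
    ∫ z, f z * (starRingEnd ℂ) (h z) ∂(dV n ν) =
      ∫ z, g z * (starRingEnd ℂ) (h z) ∂(dV n ν)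

/-- The Bergman projection `P_ν` admits a bounded extension to `L^p_ν`:
`‖P_ν f‖_{L^p_ν} ≤ C ‖f‖_{L^p_ν}` for all `f ∈ L²_ν ∩ L^p_ν`. -/
def projBounded (n : ℕ) [NeZero n] (p ν : ℝ) : Prop :=
  ∃ C > (0 : ℝ), ∀ f g : (Fin n → ℂ) → ℂ,
    AEStronglyMeasurable f (dV n ν) → lpInt n 2 ν f < ⊤ → lpInt n p ν f < ⊤ →
    isProj n ν f g → lpNorm n p ν g ≤ ENNReal.ofReal C * lpNorm n p ν f

/-- A bounded (continuous) linear functional on `A^p_ν`. -/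
def isBddFunc (n : ℕ) [NeZero n] (p ν : ℝ) (γ : ((Fin n → ℂ) → ℂ) → ℂ) : Prop :=
  (∀ F G, memA n p ν F → memA n p ν G → γ (F + G) = γ F + γ G) ∧
  (∀ (c : ℂ) (F), memA n p ν F → γ (fun z => c * F z) = c * γ F) ∧
  ∃ C : ℝ, ∀ F, memA n p ν F → ‖γ F‖ ≤ C * (lpNorm n p ν F).toReal


/-- The symmetric bilinear form polarizing `lor`. -/
def lorBilin {n : ℕ} [NeZero n] (y w : Fin n → ℝ) : ℝ := 2 * (y 0 * w 0) - ∑ i, y i * w i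

section LorentzForm

variable {n : ℕ} [NeZero n]

lemma lorBilin_self (y : Fin n → ℝ) : lorBilin y y = lor y := by
  simp [lorBilin, lor, sq]

lemma lorBilin_comm (y w : Fin n → ℝ) : lorBilin y w = lorBilin w y := by
  simp [lorBilin, mul_comm]

lemma lorBilin_add_left (x y w : Fin n → ℝ) :
    lorBilin (x + y) w = lorBilin x w + lorBilin y w := by
  simp only [lorBilin, Pi.add_apply, add_mul, Finset.sum_add_distrib]; ring

lemma lorBilin_smul_left (c : ℝ) (y w : Fin n → ℝ) :
    lorBilin (c • y) w = c * lorBilin y w := by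
  simp only [lorBilin, Pi.smul_apply, smul_eq_mul, mul_sub, Finset.mul_sum, mul_assoc]
  ring

lemma lorBilin_sub_left (x y w : Fin n → ℝ) :
    lorBilin (x - y) w = lorBilin x w - lorBilin y w := by
  simp only [lorBilin, Pi.sub_apply, sub_mul, Finset.sum_sub_distrib]; ring

lemma lor_smul (c : ℝ) (y : Fin n → ℝ) : lor (c • y) = c ^ 2 * lor y := by
  rw [← lorBilin_self, lorBilin_smul_left, lorBilin_comm, lorBilin_smul_left, lorBilin_self]
  ring

lemma lor_add (x y : Fin n → ℝ) : lor (x + y) = lor x + 2 * lorBilin x y + lor y := by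
  rw [← lorBilin_self, lorBilin_add_left, lorBilin_comm x, lorBilin_comm y, lorBilin_add_left,
    lorBilin_add_left, lorBilin_self, lorBilin_self, lorBilin_comm y x]
  ring

lemma lor_sub (x y : Fin n → ℝ) : lor (x - y) = lor x - 2 * lorBilin x y + lor y := by
  rw [← lorBilin_self, lorBilin_sub_left, lorBilin_comm x, lorBilin_comm y, lorBilin_sub_left,
    lorBilin_sub_left, lorBilin_self, lorBilin_self, lorBilin_comm y x]
  ring

lemma lor_fin_succ {m : ℕ} (y : Fin (m + 1) → ℝ) : lor y = y 0 ^ 2 - ∑ i : Fin m, y i.succ ^ 2 := by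
  rw [lor, Fin.sum_univ_succ]; ring

lemma lorBilin_pos {y w : Fin n → ℝ} (hy : y ∈ cone n) (hw : w ∈ cone n) : 0 < lorBilin y w := by
  obtain ⟨m, rfl⟩ := Nat.exists_eq_succ_of_ne_zero (NeZero.ne n)
  obtain ⟨hy, hy0⟩ := hy
  obtain ⟨hw, hw0⟩ := hw
  rw [lor_fin_succ] at hy hw
  rw [lorBilin, Fin.sum_univ_succ]
  have hcs := Finset.sum_mul_sq_le_sq_mul_sq Finset.univ (fun i : Fin m => y i.succ)
    (fun i : Fin m => w i.succ)
  have hlt : (∑ i : Fin m, y i.succ * w i.succ) ^ 2 < (y 0 * w 0) ^ 2 := by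
    refine hcs.trans_lt ?_
    rw [mul_pow]
    exact mul_lt_mul'' (by linarith) (by linarith) (by positivity) (by positivity)
  have := (abs_lt.1 (abs_lt_of_sq_lt_sq hlt (by positivity))).2
  linarith

lemma add_mem_cone {y w : Fin n → ℝ} (hy : y ∈ cone n) (hw : w ∈ cone n) : y + w ∈ cone n := by
  have := lorBilin_pos hy hw
  refine ⟨?_, add_pos hy.2 hw.2⟩
  rw [lor_add]
  linarith [hy.1, hw.1]

lemma smul_mem_cone {c : ℝ} (hc : 0 < c) {y : Fin n → ℝ} : c • y ∈ cone n ↔ y ∈ cone n := by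
  simp only [cone, mem_ofPred_eq, lor_smul, Pi.smul_apply, smul_eq_mul]
  rw [mul_pos_iff_of_pos_left (by positivity), mul_pos_iff_of_pos_left hc]

lemma lor_single_zero : lor (Pi.single 0 1 : Fin n → ℝ) = 1 := by
  have h : ∀ i : Fin n, (Pi.single 0 1 : Fin n → ℝ) i ^ 2 = (Pi.single 0 1 : Fin n → ℝ) i := by
    intro i
    by_cases hi : i = 0
    · subst hi; simp
    · simp [hi]
  simp only [lor, h, Finset.sum_pi_single']
  simp
  norm_num

lemma single_zero_mem_cone : (Pi.single 0 1 : Fin n → ℝ) ∈ cone n :=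
  ⟨by simp [lor_single_zero], by simp⟩

lemma measurable_lor : Measurable (lor : (Fin n → ℝ) → ℝ) := by
  unfold lor; fun_prop

lemma measurableSet_cone : MeasurableSet (cone n) :=
  (measurableSet_lt measurable_const measurable_lor).inter
    (measurableSet_lt measurable_const (measurable_pi_apply 0))

/-- The Lorentz transformation fixing `w` and acting as `-1` on its orthogonal complement. -/
def lorFlip (w : Fin n → ℝ) : (Fin n → ℝ) →ₗ[ℝ] (Fin n → ℝ) where
  toFun y := (2 * lorBilin y w / lor w) • w - y
  map_add' x y := by
    rw [lorBilin_add_left]; module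
  map_smul' c y := by
    rw [lorBilin_smul_left]; simp only [RingHom.id_apply]; module

lemma lorFlip_apply (w y : Fin n → ℝ) : lorFlip w y = (2 * lorBilin y w / lor w) • w - y := rfl

lemma lorBilin_lorFlip {w : Fin n → ℝ} (hw : lor w ≠ 0) (y : Fin n → ℝ) :
    lorBilin (lorFlip w y) w = lorBilin y w := by
  rw [lorFlip_apply, lorBilin_sub_left, lorBilin_smul_left, lorBilin_self]
  field_simp
  ring

lemma lorFlip_lorFlip {w : Fin n → ℝ} (hw : lor w ≠ 0) (y : Fin n → ℝ) :
    lorFlip w (lorFlip w y) = y := by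
  rw [lorFlip_apply, lorBilin_lorFlip hw, lorFlip_apply]
  abel

lemma lor_lorFlip {w : Fin n → ℝ} (hw : lor w ≠ 0) (y : Fin n → ℝ) :
    lor (lorFlip w y) = lor y := by
  rw [lorFlip_apply, lor_sub, lor_smul, lorBilin_smul_left, lorBilin_comm w]
  field_simp
  ring

lemma lorFlip_mem_cone_of_mem {w y : Fin n → ℝ} (hw : w ∈ cone n) (hy : y ∈ cone n) :
    lorFlip w y ∈ cone n := by
  have hlor : 0 < lor (lorFlip w y) := by rw [lor_lorFlip hw.1.ne']; exact hy.1
  refine ⟨hlor, ?_⟩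
  have hB : 0 < lorBilin (lorFlip w y) w := by
    rw [lorBilin_lorFlip hw.1.ne']; exact lorBilin_pos hy hw
  generalize lorFlip w y = x at *
  by_contra! h
  rcases h.lt_or_eq with h | h
  · have hx : (-1 : ℝ) • x ∈ cone n := ⟨by rw [lor_smul]; simpa using hlor, by simpa using h⟩
    have := lorBilin_pos hx hw
    rw [lorBilin_smul_left] at this
    linarith
  · have : 0 ≤ ∑ i, x i ^ 2 := by positivity
    rw [lor, h] at hlor
    linarith

lemma lorFlip_mem_cone {w y : Fin n → ℝ} (hw : w ∈ cone n) :
    lorFlip w y ∈ cone n ↔ y ∈ cone n := by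
  refine ⟨fun h => ?_, lorFlip_mem_cone_of_mem hw⟩
  simpa [lorFlip_lorFlip hw.1.ne'] using lorFlip_mem_cone_of_mem hw h

lemma lorFlip_add_of_lor_eq {u v : Fin n → ℝ} (hu : u ∈ cone n) (hv : v ∈ cone n)
    (h : lor u = lor v) : lorFlip (u + v) u = v := by
  have hpos := (add_mem_cone hu hv).1
  have : 2 * lorBilin u (u + v) / lor (u + v) = 1 := by
    rw [div_eq_one_iff_eq hpos.ne', lorBilin_comm, lorBilin_add_left, lorBilin_self, lor_add,
      lorBilin_comm v, ← h]
    ring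
  rw [lorFlip_apply, this, one_smul, add_sub_cancel_left]

lemma measurePreserving_lorFlip {w : Fin n → ℝ} (hw : lor w ≠ 0) :
    MeasurePreserving (lorFlip w) volume volume := by
  have hcomp : lorFlip w ∘ₗ lorFlip w = LinearMap.id := by
    refine LinearMap.ext fun y => ?_
    rw [LinearMap.comp_apply, LinearMap.id_apply, lorFlip_lorFlip hw]
  have hdet : LinearMap.det (lorFlip w) * LinearMap.det (lorFlip w) = 1 := by
    rw [← LinearMap.det_comp, hcomp, LinearMap.det_id]
  have habs : |(LinearMap.det (lorFlip w))⁻¹| = 1 := by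
    rcases mul_self_eq_one_iff.1 hdet with h | h <;> simp [h]
  refine ⟨(LinearMap.continuous_of_finiteDimensional _).measurable, ?_⟩
  rw [Measure.map_linearMap_addHaar_eq_smul_addHaar _ (left_ne_zero_of_mul_eq_one hdet), habs]
  simp

end LorentzForm

/-- The integral of `Δ(y+u)^{-α} Δ(y)^a` over the cone, as an extended nonnegative real. -/
def coneIntegral {n : ℕ} [NeZero n] (α a : ℝ) (u : Fin n → ℝ) : ℝ≥0∞ :=
  ∫⁻ y, (cone n).indicator (fun y => ENNReal.ofReal (lor (y + u) ^ (-α) * lor y ^ a)) y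

section ConeIntegral

variable {n : ℕ} [NeZero n]

lemma measurable_coneIntegrand (α a : ℝ) (u : Fin n → ℝ) :
    Measurable fun y => lor (y + u) ^ (-α) * lor y ^ a :=
  ((measurable_lor.comp (measurable_add_const u)).pow_const _).mul (measurable_lor.pow_const _)

lemma measurable_indicator_coneIntegrand (α a : ℝ) (u : Fin n → ℝ) :
    Measurable ((cone n).indicator fun y => ENNReal.ofReal (lor (y + u) ^ (-α) * lor y ^ a)) :=
  (measurable_coneIntegrand α a u).ennreal_ofReal.indicator measurableSet_cone

lemma coneIntegral_congr_of_lor_eq (α a : ℝ) {u v : Fin n → ℝ} (hu : u ∈ cone n) (hv : v ∈ cone n)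
    (h : lor u = lor v) : coneIntegral α a u = coneIntegral α a v := by
  have hw := add_mem_cone hu hv
  rw [coneIntegral, coneIntegral, ← (measurePreserving_lorFlip hw.1.ne').lintegral_comp
    (measurable_indicator_coneIntegrand α a v)]
  congr with y
  have hadd : lor (lorFlip (u + v) y + v) = lor (y + u) := by
    rw [← lor_lorFlip hw.1.ne' (y + u), map_add, lorFlip_add_of_lor_eq hu hv h]
  by_cases hy : y ∈ cone n
  · rw [indicator_of_mem hy, indicator_of_mem ((lorFlip_mem_cone hw).2 hy), hadd,
      lor_lorFlip hw.1.ne']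
  · rw [indicator_of_notMem hy, indicator_of_notMem (by rwa [lorFlip_mem_cone hw])]

lemma coneIntegral_smul (α a : ℝ) {s : ℝ} (hs : 0 < s) {u : Fin n → ℝ} (hu : u ∈ cone n) :
    coneIntegral α a (s • u) =
      ENNReal.ofReal (s ^ (2 * (a - α) + n)) * coneIntegral α a u := by
  have hmap := Measure.map_addHaar_smul (volume : Measure (Fin n → ℝ)) (inv_ne_zero hs.ne')
  have hF := measurable_indicator_coneIntegrand α a u
  have key : ∀ y, (cone n).indicator
        (fun y => ENNReal.ofReal (lor (y + s • u) ^ (-α) * lor y ^ a)) y =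
      ENNReal.ofReal (s ^ (2 * (a - α))) * (cone n).indicator
        (fun y => ENNReal.ofReal (lor (y + u) ^ (-α) * lor y ^ a)) (s⁻¹ • y) := by
    intro y
    obtain ⟨z, rfl⟩ : ∃ z, y = s • z := ⟨s⁻¹ • y, by rw [smul_inv_smul₀ hs.ne']⟩
    rw [inv_smul_smul₀ hs.ne']
    by_cases hz : z ∈ cone n
    · rw [indicator_of_mem ((smul_mem_cone hs).2 hz), indicator_of_mem hz,
        ← ENNReal.ofReal_mul (by positivity), ← smul_add, lor_smul, lor_smul,
        Real.mul_rpow (by positivity) (add_mem_cone hz hu).1.le,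
        Real.mul_rpow (by positivity) hz.1.le, mul_sub, sub_eq_add_neg, Real.rpow_add hs,
        ← Real.rpow_natCast, ← Real.rpow_mul hs.le, ← Real.rpow_mul hs.le]
      congr 1
      push_cast
      rw [mul_neg]
      ring
    · rw [indicator_of_notMem (by rwa [smul_mem_cone hs]), indicator_of_notMem hz, mul_zero]
  have hscale : ∫⁻ y, (cone n).indicator
      (fun y => ENNReal.ofReal (lor (y + u) ^ (-α) * lor y ^ a)) (s⁻¹ • y) =
      ENNReal.ofReal (s ^ n) * coneIntegral α a u := by
    rw [← lintegral_map hF (measurable_const_smul _), hmap, lintegral_smul_measure, coneIntegral]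
    simp [abs_of_pos hs]
  rw [coneIntegral]
  simp_rw [key]
  rw [lintegral_const_mul' _ _ ENNReal.ofReal_ne_top, hscale, ← mul_assoc,
    ← ENNReal.ofReal_mul (by positivity), Real.rpow_add hs, Real.rpow_natCast]

lemma coneIntegral_eq (α ν : ℝ) {u : Fin n → ℝ} (hu : u ∈ cone n) :
    coneIntegral α (ν - (n : ℝ) / 2) u =
      ENNReal.ofReal (lor u ^ (ν - α)) *
        coneIntegral α (ν - (n : ℝ) / 2) (Pi.single 0 1 : Fin n → ℝ) := by
  have hs : 0 < √(lor u) := Real.sqrt_pos.2 hu.1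
  have he := single_zero_mem_cone (n := n)
  rw [coneIntegral_congr_of_lor_eq α _ hu ((smul_mem_cone hs).2 he)
    (by rw [lor_smul, lor_single_zero, Real.sq_sqrt hu.1.le, mul_one]),
    coneIntegral_smul α _ hs he, Real.sqrt_eq_rpow, ← Real.rpow_mul hu.1.le]
  ring_nf

end ConeIntegral

section OneVariable

lemma rpow_neg_abs_le_rpow {x K : ℝ} (s : ℝ) (hx : 1 ≤ x) (hK : x ≤ K) : K ^ (-|s|) ≤ x ^ s :=
  (Real.rpow_le_rpow_of_nonpos (by linarith) hK (by simp)).trans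
    (Real.rpow_le_rpow_of_exponent_le hx (neg_abs_le s))

lemma rpow_le_rpow_abs {x K : ℝ} (s : ℝ) (hx : 1 ≤ x) (hK : x ≤ K) : x ^ s ≤ K ^ |s| :=
  (Real.rpow_le_rpow_of_exponent_le hx (le_abs_self s)).trans
    (Real.rpow_le_rpow (by linarith) hK (abs_nonneg s))

lemma integrableOn_rpow_mul_one_add_rpow {b α : ℝ} (hb : -1 < b) (hα : b - α < -1) :
    IntegrableOn (fun p : ℝ => p ^ b * (1 + p) ^ (-α)) (Ioi 0) := by
  rw [← Ioc_union_Ioi_eq_Ioi zero_le_one]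
  refine IntegrableOn.union ?_ ?_
  · have h := (intervalIntegrable_iff_integrableOn_Ioc_of_le zero_le_one).1
      (intervalIntegral.intervalIntegrable_rpow' (a := 0) (b := 1) hb)
    rw [← integrableOn_Icc_iff_integrableOn_Ioc] at h ⊢
    refine h.mul_continuousOn (fun p hp => ContinuousAt.continuousWithinAt ?_) isCompact_Icc
    exact ContinuousAt.rpow_const (by fun_prop) (Or.inl (by linarith [hp.1]))
  · have h := ((integrableOn_Ioi_rpow_iff zero_lt_one).2 hα).mul_const ((2 : ℝ) ^ |(-α)|)
    refine Integrable.mono' h (by fun_prop) ?_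
    filter_upwards [ae_restrict_mem measurableSet_Ioi] with p (hp : 1 < p)
    have hp0 : 0 < p := by linarith
    have hfac : 1 + p = p * (1 + 1 / p) := by field_simp; ring
    have hle : 1 / p ≤ 1 := by rw [div_le_one hp0]; exact hp.le
    rw [Real.norm_of_nonneg (by positivity), hfac, Real.mul_rpow hp0.le (by positivity), ← mul_assoc,
      ← Real.rpow_add hp0, ← sub_eq_add_neg]
    gcongr
    exact rpow_le_rpow_abs _ (by linarith [one_div_pos.2 hp0]) (by linarith)

lemma lintegral_comp_add_two_mul {g : ℝ → ℝ≥0∞} (hg : Measurable g) (q : ℝ) :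
    ∫⁻ r, g (q + 2 * r) = ENNReal.ofReal 2⁻¹ * ∫⁻ r, g r := by
  have hmap := Real.map_volume_mul_left (a := 2) two_ne_zero
  rw [← lintegral_map (f := fun x => g (q + x)) (g := fun r => 2 * r) (by fun_prop) (by fun_prop),
    hmap, lintegral_smul_measure, lintegral_add_left_eq_self]
  simp

end OneVariable

/-- The integrand of the cone integral based at `(1, 0, …, 0)` in the variables `q = y₀ - |y'|` and
`r = |y'|`, where `y = (y₀, y')`, including the polar Jacobian `r ^ d`. -/
def radialKernel (d : ℕ) (α a r q : ℝ) : ℝ :=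
  r ^ d * (((q + 1) * (q + 1 + 2 * r)) ^ (-α) * (q * (q + 2 * r)) ^ a)

section RadialKernel

variable {d : ℕ} {α a : ℝ}

lemma measurable_radialKernel :
    Measurable fun z : ℝ × ℝ => ENNReal.ofReal (radialKernel d α a z.1 z.2) := by
  unfold radialKernel; fun_prop

lemma radialKernel_nonneg {r q : ℝ} (hr : 0 < r) (hq : 0 < q) : 0 ≤ radialKernel d α a r q := by
  unfold radialKernel; positivity

lemma radialKernel_eq {r q : ℝ} (hr : 0 < r) (hq : 0 < q) :
    radialKernel d α a r q =
      r ^ d * (q ^ a * (1 + q) ^ (-α) * ((q + 2 * r) ^ a * (1 + (q + 2 * r)) ^ (-α))) := by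
  rw [radialKernel, Real.mul_rpow (by positivity) (by positivity),
    Real.mul_rpow (by positivity) (by positivity), add_comm 1 q, ← add_assoc, add_comm 1 q,
    add_right_comm]
  ring

lemma radialKernel_le {r q : ℝ} (hr : 0 < r) (hq : 0 < q) :
    radialKernel d α a r q ≤
      q ^ a * (1 + q) ^ (-α) * ((q + 2 * r) ^ (d + a) * (1 + (q + 2 * r)) ^ (-α)) := by
  have hp : 0 < q + 2 * r := by positivity
  rw [radialKernel_eq hr hq, Real.rpow_add hp, Real.rpow_natCast]
  calc _ ≤ (q + 2 * r) ^ d *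
        (q ^ a * (1 + q) ^ (-α) * ((q + 2 * r) ^ a * (1 + (q + 2 * r)) ^ (-α))) := by
        gcongr; linarith
    _ = _ := by ring

lemma lintegral_radialKernel_lt_top (ha : -1 < a) (hα : d + a - α < -1) :
    ∫⁻ r in Ioi 0, ∫⁻ q in Ioi 0, ENNReal.ofReal (radialKernel d α a r q) < ⊤ := by
  have hd : (0 : ℝ) ≤ d := d.cast_nonneg
  set A : ℝ → ℝ≥0∞ := fun q => ENNReal.ofReal (q ^ a * (1 + q) ^ (-α)) with hA
  set B : ℝ → ℝ≥0∞ :=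
    (Ioi 0).indicator fun p => ENNReal.ofReal (p ^ (d + a) * (1 + p) ^ (-α)) with hB
  have hBm : Measurable B := by
    refine Measurable.indicator ?_ measurableSet_Ioi
    fun_prop
  have hAtop : ∫⁻ q in Ioi 0, A q < ⊤ :=
    (integrableOn_rpow_mul_one_add_rpow ha (by linarith)).lintegral_lt_top
  have hBtop : ∫⁻ p, B p < ⊤ := by
    rw [hB, lintegral_indicator measurableSet_Ioi]
    exact (integrableOn_rpow_mul_one_add_rpow (by linarith) hα).lintegral_lt_top
  rw [lintegral_lintegral_swap measurable_radialKernel.aemeasurable]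
  calc ∫⁻ q in Ioi 0, ∫⁻ r in Ioi 0, ENNReal.ofReal (radialKernel d α a r q)
      ≤ ∫⁻ q in Ioi 0, ∫⁻ r in Ioi 0, A q * B (q + 2 * r) := by
        refine setLIntegral_mono' measurableSet_Ioi fun q (hq : 0 < q) => ?_
        refine setLIntegral_mono' measurableSet_Ioi fun r (hr : 0 < r) => ?_
        have hp : 0 < q + 2 * r := by positivity
        rw [hA, hB, indicator_of_mem (mem_Ioi.2 hp), ← ENNReal.ofReal_mul (by positivity)]
        exact ENNReal.ofReal_le_ofReal (radialKernel_le hr hq)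
    _ ≤ ∫⁻ q in Ioi 0, A q * (ENNReal.ofReal 2⁻¹ * ∫⁻ p, B p) := by
        refine lintegral_mono fun q => ?_
        rw [lintegral_const_mul' _ _ ENNReal.ofReal_ne_top, ← lintegral_comp_add_two_mul hBm q]
        gcongr
        exact Measure.restrict_le_self
    _ = (∫⁻ q in Ioi 0, A q) * (ENNReal.ofReal 2⁻¹ * ∫⁻ p, B p) := by
        rw [lintegral_mul_const' _ _ (ENNReal.mul_ne_top ENNReal.ofReal_ne_top hBtop.ne)]
    _ < ⊤ := ENNReal.mul_lt_top hAtop (ENNReal.mul_lt_top ENNReal.ofReal_lt_top hBtop)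

lemma exists_integrableOn_of_lintegral_lt_top {f : ℝ → ℝ → ℝ}
    (hf : Measurable fun z : ℝ × ℝ => f z.1 z.2) (hf0 : ∀ x > 0, ∀ y > 0, 0 ≤ f x y)
    (h : ∫⁻ x in Ioi 0, ∫⁻ y in Ioi 0, ENNReal.ofReal (f x y) < ⊤) :
    ∃ x > 0, IntegrableOn (f x) (Ioi 0) := by
  have hae := ae_lt_top (Measurable.lintegral_prod_right' hf.ennreal_ofReal) h.ne
  have : (ae (volume.restrict (Ioi (0 : ℝ)))).NeBot := by
    rw [ae_neBot, Ne, Measure.restrict_eq_zero]; simp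
  obtain ⟨x, hlt, hx⟩ := (hae.and (ae_restrict_mem measurableSet_Ioi)).exists
  refine ⟨x, hx, (hf.comp measurable_prodMk_left).aestronglyMeasurable, ?_⟩
  rw [hasFiniteIntegral_iff_ofReal]
  · exact hlt
  · filter_upwards [ae_restrict_mem measurableSet_Ioi] with y hy using hf0 x hx y hy

lemma lintegral_radialKernel_lt_top_iff :
    ∫⁻ r in Ioi 0, ∫⁻ q in Ioi 0, ENNReal.ofReal (radialKernel d α a r q) < ⊤ ↔
      -1 < a ∧ d + a - α < -1 := by
  refine ⟨fun h => ⟨?_, ?_⟩, fun h => lintegral_radialKernel_lt_top h.1 h.2⟩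
  · obtain ⟨r, hr, hint⟩ := exists_integrableOn_of_lintegral_lt_top
      (f := radialKernel d α a) (by unfold radialKernel; fun_prop)
      (fun r hr q hq => radialKernel_nonneg hr hq) h
    have hint := hint.mono_set (fun q (hq : q ∈ Ioc (0 : ℝ) 1) => hq.1)
    rw [← integrableOn_Icc_iff_integrableOn_Ioc] at hint
    have hcont : ContinuousOn
        (fun q : ℝ => (r ^ d * ((1 + q) ^ (-α) * ((q + 2 * r) ^ a * (1 + (q + 2 * r)) ^ (-α))))⁻¹)
        (Icc 0 1) := by
      intro q hq
      have hq0 : 0 ≤ q := hq.1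
      refine ContinuousAt.continuousWithinAt ?_
      have h₁ : 1 + q ≠ 0 := by positivity
      have h₂ : q + 2 * r ≠ 0 := by positivity
      have h₃ : 1 + (q + 2 * r) ≠ 0 := by positivity
      refine ContinuousAt.inv₀ (continuousAt_const.mul ?_) (by positivity)
      exact (ContinuousAt.rpow_const (by fun_prop) (Or.inl h₁)).mul
        ((ContinuousAt.rpow_const (f := fun q : ℝ => q + 2 * r) (by fun_prop) (Or.inl h₂)).mul
          (ContinuousAt.rpow_const (by fun_prop) (Or.inl h₃)))
    have hmul := (hint.mul_continuousOn hcont isCompact_Icc).mono_set Ioo_subset_Icc_self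
    rw [← intervalIntegral.integrableOn_Ioo_rpow_iff zero_lt_one]
    refine hmul.congr_fun (fun q hq => ?_) measurableSet_Ioo
    have hq0 : 0 < q := hq.1
    simp only [radialKernel_eq hr hq0]
    field_simp
  · rw [lintegral_lintegral_swap measurable_radialKernel.aemeasurable] at h
    obtain ⟨q, hq, hint⟩ := exists_integrableOn_of_lintegral_lt_top
      (f := fun q r => radialKernel d α a r q) (by unfold radialKernel; fun_prop)
      (fun q hq r hr => radialKernel_nonneg hr hq) h
    have hint := (hint.mono_set (Ioi_subset_Ioi zero_le_one)).const_mul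
      (q ^ a * (1 + q) ^ (-α) * ((q + 3) ^ (-|a|) * (q + 3) ^ (-|(-α)|)))⁻¹
    rw [← integrableOn_Ioi_rpow_iff zero_lt_one]
    refine Integrable.mono' hint (by fun_prop) ?_
    filter_upwards [ae_restrict_mem measurableSet_Ioi] with r (hr : 1 < r)
    have hr0 : 0 < r := by linarith
    have hfac₁ : q + 2 * r = r * (2 + q / r) := by field_simp; ring
    have hfac₂ : 1 + (q + 2 * r) = r * (2 + (1 + q) / r) := by field_simp; ring
    have hle₁ : q / r ≤ q := div_le_self hq.le hr.le
    have hle₂ : (1 + q) / r ≤ 1 + q := div_le_self (by positivity) hr.le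
    have hnn₁ : 0 ≤ q / r := by positivity
    have hnn₂ : 0 ≤ (1 + q) / r := by positivity
    rw [Real.norm_of_nonneg (by positivity), radialKernel_eq hr0 hq, hfac₂, hfac₁,
      Real.mul_rpow hr0.le (by positivity), Real.mul_rpow hr0.le (by positivity),
      le_inv_mul_iff₀ (by positivity), sub_eq_add_neg, Real.rpow_add hr0, Real.rpow_add hr0,
      Real.rpow_natCast]
    calc _ = r ^ d * (q ^ a * (1 + q) ^ (-α) *
          (r ^ a * (q + 3) ^ (-|a|) * (r ^ (-α) * (q + 3) ^ (-|(-α)|)))) := by ring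
      _ ≤ _ := by
        gcongr
        · exact rpow_neg_abs_le_rpow _ (by linarith) (by linarith)
        · exact rpow_neg_abs_le_rpow _ (by linarith) (by linarith)

end RadialKernel

section Polar

variable {E : Type*} [NormedAddCommGroup E] [NormedSpace ℝ E] [FiniteDimensional ℝ E]
  [MeasurableSpace E] [BorelSpace E] [Nontrivial E]

/-- Polar coordinates for the Lebesgue integral of a radial function. -/
lemma lintegral_fun_norm_addHaar (μ : Measure E) [μ.IsAddHaarMeasure] {f : ℝ → ℝ≥0∞}
    (hf : Measurable f) :
    ∫⁻ x, f ‖x‖ ∂μ = μ.toSphere univ *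
      ∫⁻ r in Ioi (0 : ℝ), ENNReal.ofReal (r ^ (Module.finrank ℝ E - 1)) * f r := by
  have hsub : Measurable fun r : Ioi (0 : ℝ) => f r := hf.comp measurable_subtype_coe
  have hpres := μ.measurePreserving_homeomorphUnitSphereProd.lintegral_comp
    (hsub.comp measurable_snd)
  simp only [Function.comp_apply, homeomorphUnitSphereProd_apply_snd_coe] at hpres
  have hcompl : ∫⁻ x, f ‖x‖ ∂μ = ∫⁻ x : ({0}ᶜ : Set E), f ‖x.1‖ ∂(μ.comap (↑)) := by
    rw [lintegral_subtype_comap (measurableSet_singleton _).compl fun x => f ‖x‖,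
      restrict_compl_singleton]
  rw [hcompl, hpres, lintegral_prod (fun b : Metric.sphere (0 : E) 1 × Ioi (0 : ℝ) => f b.2)
    (hsub.comp measurable_snd).aemeasurable]
  simp only [lintegral_const]
  rw [mul_comm, Measure.volumeIoiPow, lintegral_withDensity_eq_lintegral_mul _ (by fun_prop) hsub]
  simp only [Pi.mul_apply]
  rw [lintegral_subtype_comap measurableSet_Ioi
    fun r : ℝ => ENNReal.ofReal (r ^ (Module.finrank ℝ E - 1)) * f r]

lemma toSphere_univ_ne_zero (μ : Measure E) [μ.IsAddHaarMeasure] : μ.toSphere univ ≠ 0 := by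
  rw [Measure.toSphere_apply_univ]
  exact mul_ne_zero (by exact_mod_cast Module.finrank_pos.ne')
    (Metric.measure_ball_pos μ _ one_pos).ne'

end Polar

section Reduction

variable {m : ℕ} (α a : ℝ)

/-- The integrand of the cone integral based at `(1, 0, …, 0)` as a function of `t = y₀` and
`r = |y'|`, where `y = (y₀, y')`. -/
def axialKernel (t r : ℝ) : ℝ≥0∞ :=
  (Ioi r).indicator
    (fun t => ENNReal.ofReal (((t + 1) ^ 2 - r ^ 2) ^ (-α) * (t ^ 2 - r ^ 2) ^ a)) t

lemma measurable_axialKernel : Measurable fun z : ℝ × ℝ => axialKernel α a z.1 z.2 := by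
  have : (fun z : ℝ × ℝ => axialKernel α a z.1 z.2) = {z : ℝ × ℝ | z.2 < z.1}.indicator
      fun z => ENNReal.ofReal (((z.1 + 1) ^ 2 - z.2 ^ 2) ^ (-α) * (z.1 ^ 2 - z.2 ^ 2) ^ a) := by
    ext z
    simp [axialKernel, indicator]
  rw [this]
  exact Measurable.indicator (by fun_prop) (measurableSet_lt measurable_snd measurable_fst)

lemma lor_cons (t : ℝ) (x : Fin m → ℝ) :
    lor (Fin.cons t x : Fin (m + 1) → ℝ) = t ^ 2 - ‖WithLp.toLp 2 x‖ ^ 2 := by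
  rw [lor_fin_succ, EuclideanSpace.real_norm_sq_eq]
  simp

lemma cons_mem_cone (t : ℝ) (x : Fin m → ℝ) :
    (Fin.cons t x : Fin (m + 1) → ℝ) ∈ cone (m + 1) ↔ ‖WithLp.toLp 2 x‖ < t := by
  simp only [cone, mem_ofPred_eq, lor_cons, Fin.cons_zero, sub_pos]
  constructor
  · rintro ⟨h, ht⟩
    exact lt_of_pow_lt_pow_left₀ 2 ht.le h
  · intro h
    exact ⟨pow_lt_pow_left₀ h (norm_nonneg _) two_ne_zero, (norm_nonneg _).trans_lt h⟩

lemma indicator_coneIntegrand_cons (t : ℝ) (x : Fin m → ℝ) :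
    (cone (m + 1)).indicator
      (fun y => ENNReal.ofReal (lor (y + Pi.single 0 1) ^ (-α) * lor y ^ a)) (Fin.cons t x) =
      axialKernel α a t ‖WithLp.toLp 2 x‖ := by
  have hadd : (Fin.cons t x + Pi.single 0 1 : Fin (m + 1) → ℝ) = Fin.cons (t + 1) x := by
    ext i
    refine Fin.cases ?_ (fun j => ?_) i <;> simp
  by_cases h : ‖WithLp.toLp 2 x‖ < t
  · rw [indicator_of_mem ((cons_mem_cone t x).2 h), axialKernel, indicator_of_mem (mem_Ioi.2 h),
      hadd, lor_cons, lor_cons]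
  · rw [indicator_of_notMem (by rwa [cons_mem_cone]), axialKernel,
      indicator_of_notMem (by simpa using h)]

lemma coneIntegral_single_eq_lintegral :
    coneIntegral α a (Pi.single 0 1 : Fin (m + 1) → ℝ) =
      ∫⁻ x : EuclideanSpace ℝ (Fin m), ∫⁻ t, axialKernel α a t ‖x‖ := by
  have hpres := (volume_preserving_piFinSuccAbove (fun _ : Fin (m + 1) => ℝ) 0).symm
  have hmeas := measurable_axialKernel α a
  rw [coneIntegral, ← hpres.lintegral_comp (measurable_indicator_coneIntegrand α a _)]
  simp only [MeasurableEquiv.piFinSuccAbove_symm_apply, Fin.insertNthEquiv_zero]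
  have hcons : ∀ z : ℝ × (Fin m → ℝ), (cone (m + 1)).indicator
      (fun y => ENNReal.ofReal (lor (y + Pi.single 0 1) ^ (-α) * lor y ^ a)) (Fin.cons z.1 z.2) =
      axialKernel α a z.1 ‖WithLp.toLp 2 z.2‖ := fun z => indicator_coneIntegrand_cons α a z.1 z.2
  have hnorm : Measurable fun z : ℝ × (Fin m → ℝ) => axialKernel α a z.1 ‖WithLp.toLp 2 z.2‖ :=
    hmeas.comp (measurable_fst.prodMk
      (((PiLp.volume_preserving_toLp (Fin m)).measurable.comp measurable_snd).norm))
  have hinner : Measurable fun x : EuclideanSpace ℝ (Fin m) => ∫⁻ t, axialKernel α a t ‖x‖ :=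
    (Measurable.lintegral_prod_left' hmeas).comp measurable_norm
  rw [← (PiLp.volume_preserving_toLp (Fin m)).lintegral_comp hinner,
    ← lintegral_prod_symm' _ hnorm]
  exact lintegral_congr hcons

lemma lintegral_axialKernel {r : ℝ} :
    ∫⁻ t, axialKernel α a t r =
      ∫⁻ q in Ioi 0, ENNReal.ofReal
        (((q + 1) * (q + 1 + 2 * r)) ^ (-α) * (q * (q + 2 * r)) ^ a) := by
  rw [← lintegral_add_right_eq_self _ r, ← lintegral_indicator measurableSet_Ioi]
  refine lintegral_congr fun q => ?_
  have h₁ : (q + r + 1) ^ 2 - r ^ 2 = (q + 1) * (q + 1 + 2 * r) := by ring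
  have h₂ : (q + r) ^ 2 - r ^ 2 = q * (q + 2 * r) := by ring
  simp only [axialKernel, indicator, mem_Ioi, lt_add_iff_pos_left, h₁, h₂]

lemma coneIntegral_single_lt_top_iff (hm : 0 < m) :
    coneIntegral α a (Pi.single 0 1 : Fin (m + 1) → ℝ) < ⊤ ↔
      -1 < a ∧ ((m - 1 : ℕ) : ℝ) + a - α < -1 := by
  have : Nonempty (Fin m) := ⟨⟨0, hm⟩⟩
  have hinner : Measurable fun r => ∫⁻ t, axialKernel α a t r :=
    Measurable.lintegral_prod_left' (measurable_axialKernel α a)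
  have hcongr : ∫⁻ r in Ioi (0 : ℝ), ENNReal.ofReal (r ^ (m - 1)) * ∫⁻ t, axialKernel α a t r =
      ∫⁻ r in Ioi 0, ∫⁻ q in Ioi 0, ENNReal.ofReal (radialKernel (m - 1) α a r q) := by
    refine setLIntegral_congr_fun measurableSet_Ioi fun r (hr : 0 < r) => ?_
    simp only [lintegral_axialKernel, radialKernel]
    rw [← lintegral_const_mul' _ _ ENNReal.ofReal_ne_top]
    refine lintegral_congr fun q => ?_
    rw [ENNReal.ofReal_mul (p := r ^ (m - 1)) (by positivity)]
  rw [coneIntegral_single_eq_lintegral, lintegral_fun_norm_addHaar volume hinner,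
    finrank_euclideanSpace_fin, hcongr, ← lintegral_radialKernel_lt_top_iff]
  refine ⟨fun h => ?_, fun h => ENNReal.mul_lt_top (measure_lt_top _ _) h⟩
  by_contra! htop
  rw [top_le_iff.1 htop, ENNReal.mul_top (toSphere_univ_ne_zero _)] at h
  exact lt_irrefl _ h

end Reduction

lemma coneIntegral_eq_setLIntegral {n : ℕ} [NeZero n] (α a : ℝ) (u : Fin n → ℝ) :
    coneIntegral α a u = ∫⁻ y in cone n, ENNReal.ofReal (lor (y + u) ^ (-α) * lor y ^ a) :=
  lintegral_indicator measurableSet_cone _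

lemma coneIntegrand_nonneg_ae {n : ℕ} [NeZero n] (α a : ℝ) {u : Fin n → ℝ} (hu : u ∈ cone n) :
    0 ≤ᵐ[volume.restrict (cone n)] fun y => lor (y + u) ^ (-α) * lor y ^ a := by
  filter_upwards [ae_restrict_mem measurableSet_cone] with y hy
  exact mul_nonneg (Real.rpow_nonneg (add_mem_cone hy hu).1.le _) (Real.rpow_nonneg hy.1.le _)

/-- Lemma: `∫_Λ Δ(y+u)^{−α} Δ(y)^{ν−n/2} dy = c_α Δ(u)^{ν−α}`. -/
theorem lorentz_integral_cone (n : ℕ) [NeZero n] (hn : 3 ≤ n) (α ν : ℝ) :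
    (∀ u ∈ cone n,
      (IntegrableOn (fun y : Fin n → ℝ => lor (y + u) ^ (-α) * lor y ^ (ν - (n : ℝ) / 2))
          (cone n) volume ↔
        ((n : ℝ) / 2 - 1 < ν ∧ ν + (n : ℝ) / 2 - 1 < α))) ∧
    (((n : ℝ) / 2 - 1 < ν ∧ ν + (n : ℝ) / 2 - 1 < α) → ∃ c : ℝ, ∀ u ∈ cone n,
      (∫ y in cone n, lor (y + u) ^ (-α) * lor y ^ (ν - (n : ℝ) / 2) ∂volume)
        = c * lor u ^ (ν - α)) := by

  refine ⟨fun u hu => ?_, fun _ =>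
    ⟨(coneIntegral α (ν - (n : ℝ) / 2) (Pi.single 0 1 : Fin n → ℝ)).toReal, fun u hu => ?_⟩⟩
  · have hint : IntegrableOn (fun y => lor (y + u) ^ (-α) * lor y ^ (ν - (n : ℝ) / 2)) (cone n) ↔
        coneIntegral α (ν - (n : ℝ) / 2) u < ⊤ := by
      rw [coneIntegral_eq_setLIntegral,
        ← hasFiniteIntegral_iff_ofReal (coneIntegrand_nonneg_ae α _ hu)]
      exact ⟨fun h => h.2, fun h => ⟨(measurable_coneIntegrand α _ u).aestronglyMeasurable, h⟩⟩
    have hne : ENNReal.ofReal (lor u ^ (ν - α)) ≠ 0 := by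
      simpa using Real.rpow_pos_of_pos hu.1 _
    rw [hint, coneIntegral_eq α ν hu, ENNReal.mul_lt_top_iff]
    obtain ⟨m, rfl⟩ := Nat.exists_eq_succ_of_ne_zero (NeZero.ne n)
    have hm : 1 ≤ m := by omega
    have hiff := coneIntegral_single_lt_top_iff α (ν - ((m + 1 : ℕ) : ℝ) / 2) hm
    rw [Nat.cast_sub hm] at hiff
    push_cast at hiff ⊢
    constructor
    · rintro (h | h | h)
      · obtain ⟨h₁, h₂⟩ := hiff.1 h.2
        constructor <;> linarith
      · exact absurd h hne
      · obtain ⟨h₁, h₂⟩ := hiff.1 (h ▸ ENNReal.zero_lt_top)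
        constructor <;> linarith
    · rintro ⟨h₁, h₂⟩
      exact Or.inl ⟨ENNReal.ofReal_lt_top, hiff.2 ⟨by linarith, by linarith⟩⟩
  · rw [integral_eq_lintegral_of_nonneg_ae (coneIntegrand_nonneg_ae α _ hu)
      (measurable_coneIntegrand α _ u).aestronglyMeasurable, ← coneIntegral_eq_setLIntegral,
      coneIntegral_eq α ν hu, ENNReal.toReal_mul,
      ENNReal.toReal_ofReal (Real.rpow_nonneg hu.1.le _), mul_comm]
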